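/- For every real number θ, the double integral ∫₀^{2π} ∫₀^{2π} |cos φ·cos ψ·cos²θ + sin φ·sin ψ·sin²θ| dφ dψ lies between 4π and 16, i.e. 4π ≤ ∫₀^{2π} ∫₀^{2π} |cos φ·cos ψ·cos²θ + sin φ·sin ψ·sin²θ| dφ dψ ≤ 16. -/

import Mathlib

open Real intervalIntegral

theorem periodic_abs_cos : Function.Periodic (fun x : ℝ => |Real.cos x|) π := fun x => by
  simp [Real.cos_add_pi]

theorem integral_abs_cos_period (t : ℝ) : ∫ x in t..(t + π), |Real.cos x| = 2 := by
  have h : ∫ x in (-(π / 2))..(π / 2), |Real.cos x| = ∫ x in (-(π / 2))..(π / 2), Real.cos x := by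
    refine integral_congr fun x hx => ?_
    rw [Set.uIcc_of_le (by linarith [pi_pos])] at hx
    exact abs_of_nonneg (Real.cos_nonneg_of_mem_Icc hx)
  rw [periodic_abs_cos.intervalIntegral_add_eq t (-(π / 2)),
    show -(π / 2) + π = π / 2 by ring, h, integral_cos, Real.sin_neg, Real.sin_pi_div_two]
  norm_num

theorem integral_abs_cos_two_periods (t : ℝ) : ∫ x in t..(t + 2 * π), |Real.cos x| = 4 := by
  have hc : Continuous fun x : ℝ => |Real.cos x| := by fun_prop
  rw [← integral_add_adjacent_intervals (hc.intervalIntegrable t (t + π))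
    (hc.intervalIntegrable _ _), show t + 2 * π = t + π + π by ring,
    integral_abs_cos_period, integral_abs_cos_period]
  norm_num

theorem integral_abs_sin_two_periods : ∫ x in (0:ℝ)..(2 * π), |Real.sin x| = 4 := by
  have h := integral_comp_sub_right (a := 0) (b := 2 * π) (fun x => |Real.cos x|) (π / 2)
  simp only [Real.cos_sub_pi_div_two] at h
  rw [h, show 2 * π - π / 2 = 0 - π / 2 + 2 * π by ring, integral_abs_cos_two_periods]

theorem integral_abs_cos_add_sin (a b : ℝ) :
    ∫ x in (0:ℝ)..(2 * π), |a * Real.cos x + b * Real.sin x| = 4 * √(a ^ 2 + b ^ 2) := by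
  set z : ℂ := ⟨a, b⟩
  have hz : ‖z‖ = √(a ^ 2 + b ^ 2) := Complex.norm_eq_sqrt_sq_add_sq z
  have ha : ‖z‖ * Real.cos z.arg = a := Complex.norm_mul_cos_arg z
  have hb : ‖z‖ * Real.sin z.arg = b := Complex.norm_mul_sin_arg z
  have h (x : ℝ) : |a * Real.cos x + b * Real.sin x| = ‖z‖ * |Real.cos (x - z.arg)| := by
    rw [← abs_of_nonneg (norm_nonneg z), ← abs_mul,
      Real.cos_sub]
    congr 1
    linear_combination -Real.cos x * ha - Real.sin x * hb
  simp only [h]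
  rw [integral_const_mul, integral_comp_sub_right (fun x => |Real.cos x|),
    show 2 * π - z.arg = 0 - z.arg + 2 * π by ring, integral_abs_cos_two_periods, hz, mul_comm]

theorem double_integral_bounds (θ : ℝ) :
    4 * π ≤
      (∫ ψ in (0:ℝ)..(2 * π), ∫ φ in (0:ℝ)..(2 * π),
        |Real.cos φ * Real.cos ψ * Real.cos θ ^ 2 +
          Real.sin φ * Real.sin ψ * Real.sin θ ^ 2|) ∧
    (∫ ψ in (0:ℝ)..(2 * π), ∫ φ in (0:ℝ)..(2 * π),
        |Real.cos φ * Real.cos ψ * Real.cos θ ^ 2 +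
          Real.sin φ * Real.sin ψ * Real.sin θ ^ 2|) ≤ 16 := by
  have hcs := Real.cos_sq_add_sin_sq θ
  have hc0 := sq_nonneg (Real.cos θ)
  have hs0 := sq_nonneg (Real.sin θ)
  generalize Real.cos θ ^ 2 = c at *
  generalize Real.sin θ ^ 2 = s at *
  have inner (ψ : ℝ) : ∫ φ in (0:ℝ)..(2 * π),
      |Real.cos φ * Real.cos ψ * c + Real.sin φ * Real.sin ψ * s| =
        4 * √((c * Real.cos ψ) ^ 2 + (s * Real.sin ψ) ^ 2) := by
    rw [← integral_abs_cos_add_sin]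
    congr! 3
    ring
  simp only [inner]
  have hpi : (0:ℝ) ≤ 2 * π := by positivity
  have hint : IntervalIntegrable
      (fun ψ => 4 * √((c * Real.cos ψ) ^ 2 + (s * Real.sin ψ) ^ 2))
      MeasureTheory.volume 0 (2 * π) :=
    Continuous.intervalIntegrable (by fun_prop) _ _
  constructor
  · have hlow : ∫ ψ in (0:ℝ)..(2 * π), 4 * (c * Real.cos ψ ^ 2 + s * Real.sin ψ ^ 2) =
        4 * π := by
      rw [integral_const_mul, integral_add (Continuous.intervalIntegrable (by fun_prop) _ _)
        (Continuous.intervalIntegrable (by fun_prop) _ _), integral_const_mul,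
        integral_const_mul, integral_cos_sq, integral_sin_sq]
      simp only [Real.sin_two_pi, Real.sin_zero]
      linear_combination 4 * π * hcs
    rw [← hlow]
    refine integral_mono_on hpi (Continuous.intervalIntegrable (by fun_prop) _ _) hint
      fun ψ _ => mul_le_mul_of_nonneg_left (Real.le_sqrt_of_sq_le ?_) (by norm_num)
    have key : (c * Real.cos ψ) ^ 2 + (s * Real.sin ψ) ^ 2 -
        (c * Real.cos ψ ^ 2 + s * Real.sin ψ ^ 2) ^ 2 =
          Real.cos ψ ^ 2 * Real.sin ψ ^ 2 * (c - s) ^ 2 := by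
      rw [Real.sin_sq, mul_pow s, Real.sin_sq]
      ring
    have : 0 ≤ Real.cos ψ ^ 2 * Real.sin ψ ^ 2 * (c - s) ^ 2 := by positivity
    linarith
  · have hup : ∫ ψ in (0:ℝ)..(2 * π), 4 * (c * |Real.cos ψ| + s * |Real.sin ψ|) = 16 := by
      have hcos := integral_abs_cos_two_periods 0
      rw [zero_add] at hcos
      rw [integral_const_mul, integral_add (Continuous.intervalIntegrable (by fun_prop) _ _)
        (Continuous.intervalIntegrable (by fun_prop) _ _), integral_const_mul,
        integral_const_mul, hcos, integral_abs_sin_two_periods]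
      linear_combination 16 * hcs
    rw [← hup]
    refine integral_mono_on hpi hint (Continuous.intervalIntegrable (by fun_prop) _ _)
      fun ψ _ => mul_le_mul_of_nonneg_left (Real.sqrt_le_iff.2 ⟨by positivity, ?_⟩) (by norm_num)
    rw [← sq_abs (c * _), ← sq_abs (s * _), abs_mul, abs_mul, abs_of_nonneg hc0,
      abs_of_nonneg hs0]
    have : 0 ≤ (c * |Real.cos ψ|) * (s * |Real.sin ψ|) := by positivity
    linarith [add_sq (c * |Real.cos ψ|) (s * |Real.sin ψ|)]
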